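/- arXiv:2107.07867 — 2 statements merged into one kernel-verified Lean document; each statement's English description precedes it below -/
import Mathlib

section
/- Let n be a nonempty finite index set, M ≥ 1, and let B : Fin (M+1) → Fin (M+1) → Matrix n n ℝ be a family of real square blocks that is block-tridiagonal, i.e. B l k = 0 whenever the indices l and k differ by more than 1. Suppose R : Fin (M+1) → Matrix n n ℝ is a family of matrices satisfying the rate-matrix equations: B l (l+1) + R l * B (l+1) (l+1) + R l * R (l+1) * B (l+2) (l+1) = 0 for all l ≤ M-2, and B (M-1) M + R (M-1) * B M M = 0. Let x : Fin (M+1) → (n → ℝ) be a family of row vectors such that (x 0) ⬝ (B 0 0 + R 0 * B 1 0) = 0 and x (l+1) = (x l) ⬝ (R l) for all l < M. Then the concatenated row vector x lies in the left kernel of the block matrix B, i.e. for every k in Fin (M+1), ∑_{l} (x l) ⬝ (B l k) = 0. -/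
open Matrix

/-- Steps 3–4 of the Baumann–Sandmann matrix-analytic algorithm: if the rate
matrices `R l` satisfy the rate-matrix equations for a block-tridiagonal family
`B`, and `x` is built by `x 0 ⬝ (B 0 0 + R 0 * B 1 0) = 0`, `x (l+1) = x l ⬝ R l`,
then the concatenated row vector `x` lies in the left kernel of `B`. -/
theorem ldqbd_matrix_geometric_left_kernel
    {n : Type*} [Fintype n] [DecidableEq n] [Nonempty n]
    (M : ℕ) (hM : 1 ≤ M)
    (B : Fin (M + 1) → Fin (M + 1) → Matrix n n ℝ)
    (htri : ∀ l k : Fin (M + 1), 1 < |(l : ℤ) - (k : ℤ)| → B l k = 0)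
    (R : Fin (M + 1) → Matrix n n ℝ)
    (hrate : ∀ l : ℕ, ∀ h : l + 2 ≤ M,
      B ⟨l, by omega⟩ ⟨l + 1, by omega⟩
        + R ⟨l, by omega⟩ * B ⟨l + 1, by omega⟩ ⟨l + 1, by omega⟩
        + R ⟨l, by omega⟩ * R ⟨l + 1, by omega⟩ * B ⟨l + 2, by omega⟩ ⟨l + 1, by omega⟩
        = 0)
    (hratetop : B ⟨M - 1, by omega⟩ ⟨M, by omega⟩
        + R ⟨M - 1, by omega⟩ * B ⟨M, by omega⟩ ⟨M, by omega⟩ = 0)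
    (x : Fin (M + 1) → n → ℝ)
    (hx0 : (x ⟨0, by omega⟩) ᵥ* (B ⟨0, by omega⟩ ⟨0, by omega⟩
        + R ⟨0, by omega⟩ * B ⟨1, by omega⟩ ⟨0, by omega⟩) = 0)
    (hxrec : ∀ l : ℕ, ∀ h : l < M,
      x ⟨l + 1, by omega⟩ = (x ⟨l, by omega⟩) ᵥ* (R ⟨l, by omega⟩)) :
    ∀ k : Fin (M + 1), ∑ l : Fin (M + 1), (x l) ᵥ* (B l k) = 0 := by
  have hz : ∀ l k : Fin (M + 1), (l.val + 1 < k.val ∨ k.val + 1 < l.val) →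
      (x l) ᵥ* (B l k) = 0 := by
    intro l k h
    rw [htri l k, Matrix.vecMul_zero]
    rw [lt_abs]
    omega
  obtain ⟨m, rfl⟩ : ∃ m, M = m + 1 := ⟨M - 1, by omega⟩
  rintro ⟨k, hk⟩
  rcases k with _ | l
  · rw [← Finset.sum_subset (Finset.subset_univ
      ({⟨0, by omega⟩, ⟨1, by omega⟩} : Finset (Fin (m + 1 + 1))))]
    · rw [Finset.sum_pair (by simp [Fin.ext_iff])]
      have h1 := hxrec 0 (by omega)
      simp only [Nat.zero_add] at h1
      rw [h1, Matrix.vecMul_vecMul, ← Matrix.vecMul_add]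
      exact hx0
    · intro j _ hj
      apply hz
      simp only [Finset.mem_insert, Finset.mem_singleton, Fin.ext_iff] at hj
      simp only
      omega
  · by_cases hl : l + 2 ≤ m + 1
    · rw [← Finset.sum_subset (Finset.subset_univ
        ({⟨l, by omega⟩, ⟨l + 1, by omega⟩, ⟨l + 2, by omega⟩} : Finset (Fin (m + 1 + 1))))]
      · rw [Finset.sum_insert (by simp [Fin.ext_iff]), Finset.sum_pair (by simp [Fin.ext_iff])]
        have h1 := hxrec l (by omega)
        have h2 := hxrec (l + 1) (by omega)
        rw [h2, h1, Matrix.vecMul_vecMul, Matrix.vecMul_vecMul, Matrix.vecMul_vecMul,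
          ← Matrix.vecMul_add, ← Matrix.vecMul_add, ← add_assoc, ← Matrix.mul_assoc, hrate l hl,
          Matrix.vecMul_zero]
      · intro j _ hj
        apply hz
        simp only [Finset.mem_insert, Finset.mem_singleton, Fin.ext_iff] at hj
        simp only
        omega
    · obtain rfl : l = m := by omega
      rw [← Finset.sum_subset (Finset.subset_univ
        ({⟨l, by omega⟩, ⟨l + 1, by omega⟩} : Finset (Fin (l + 1 + 1))))]
      · rw [Finset.sum_pair (by simp [Fin.ext_iff])]
        have h1 := hxrec l (by omega)
        simp only [Nat.add_sub_cancel] at hratetop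
        rw [h1, Matrix.vecMul_vecMul, ← Matrix.vecMul_add, hratetop, Matrix.vecMul_zero]
      · intro j _ hj
        apply hz
        simp only [Finset.mem_insert, Finset.mem_singleton, Fin.ext_iff] at hj
        simp only
        omega
end

section
/- Let n be a nonempty finite index set, M ≥ 1, and let B : Fin (M+1) → Fin (M+1) → Matrix n n ℝ be block-tridiagonal (B l k = 0 whenever |l - k| > 1). Define R : Fin (M+1) → Matrix n n ℝ backwards by R M = 0 and R (l-1) = -(B (l-1) l) * (B l l + R l * B (l+1) l)⁻¹ (the term R M * B (M+1) M being absent at the top level), assuming each matrix B l l + R l * B (l+1) l appearing in the recursion is invertible. Let x 0 be a row vector with (x 0) ⬝ (B 0 0 + R 0 * B 1 0) = 0 and set x (l+1) = (x l) ⬝ (R l). Then for every k in Fin (M+1), ∑_{l} (x l) ⬝ (B l k) = 0; i.e. the vector produced by the algorithm lies in the left kernel of the block matrix B. -/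
open Matrix

/-- Full correctness of the Baumann–Sandmann matrix-analytic algorithm
(Steps 1–4): with `R M = 0` and the backward recursion
`R (l-1) = -(B (l-1) l) * (B l l + R l * B (l+1) l)⁻¹` (the term
`R M * B (M+1) M` being absent at the top level), the vector built by
`x 0 ⬝ (B 0 0 + R 0 * B 1 0) = 0`, `x (l+1) = x l ⬝ R l` lies in the
left kernel of the block-tridiagonal matrix `B`. -/
theorem ldqbd_algorithm_correctness
    {n : Type*} [Fintype n] [DecidableEq n] [Nonempty n]
    (M : ℕ) (hM : 1 ≤ M)
    (B : Fin (M + 1) → Fin (M + 1) → Matrix n n ℝ)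
    (htri : ∀ l k : Fin (M + 1), 1 < |(l : ℤ) - (k : ℤ)| → B l k = 0)
    (R : Fin (M + 1) → Matrix n n ℝ)
    (hRM : R ⟨M, by omega⟩ = 0)
    (hRtop : R ⟨M - 1, by omega⟩
        = -(B ⟨M - 1, by omega⟩ ⟨M, by omega⟩) * (B ⟨M, by omega⟩ ⟨M, by omega⟩)⁻¹)
    (hRrec : ∀ l : ℕ, ∀ h1 : 1 ≤ l, ∀ h2 : l + 1 ≤ M,
      R ⟨l - 1, by omega⟩
        = -(B ⟨l - 1, by omega⟩ ⟨l, by omega⟩)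
            * (B ⟨l, by omega⟩ ⟨l, by omega⟩
                + R ⟨l, by omega⟩ * B ⟨l + 1, by omega⟩ ⟨l, by omega⟩)⁻¹)
    (hinvtop : IsUnit (B ⟨M, by omega⟩ ⟨M, by omega⟩))
    (hinv : ∀ l : ℕ, ∀ h1 : 1 ≤ l, ∀ h2 : l + 1 ≤ M,
      IsUnit (B ⟨l, by omega⟩ ⟨l, by omega⟩
        + R ⟨l, by omega⟩ * B ⟨l + 1, by omega⟩ ⟨l, by omega⟩))
    (x : Fin (M + 1) → n → ℝ)
    (hx0 : (x ⟨0, by omega⟩) ᵥ* (B ⟨0, by omega⟩ ⟨0, by omega⟩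
        + R ⟨0, by omega⟩ * B ⟨1, by omega⟩ ⟨0, by omega⟩) = 0)
    (hxrec : ∀ l : ℕ, ∀ h : l < M,
      x ⟨l + 1, by omega⟩ = (x ⟨l, by omega⟩) ᵥ* (R ⟨l, by omega⟩)) :
    ∀ k : Fin (M + 1), ∑ l : Fin (M + 1), (x l) ᵥ* (B l k) = 0 := by
  have hzero : ∀ l k : Fin (M + 1), (l.val + 1 < k.val ∨ k.val + 1 < l.val) →
      (x l) ᵥ* (B l k) = 0 := by
    intro l k h
    rw [htri l k (by rw [lt_abs]; omega), Matrix.vecMul_zero]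
  rintro ⟨k, hk⟩
  rcases Nat.eq_zero_or_pos k with rfl | hk0
  · rw [← Finset.sum_subset (Finset.subset_univ
      ({⟨0, by omega⟩, ⟨1, by omega⟩} : Finset (Fin (M + 1))))]
    · rw [Finset.sum_pair (by simp)]
      have h := hxrec 0 (by omega)
      simp only [Nat.zero_add] at h
      rw [h, Matrix.vecMul_vecMul, ← Matrix.vecMul_add]
      exact hx0
    · intro l _ hl
      apply hzero
      simp only [Finset.mem_insert, Finset.mem_singleton, Fin.ext_iff] at hl
      simp only
      omega
  obtain ⟨j, rfl⟩ : ∃ j, k = j + 1 := ⟨k - 1, by omega⟩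
  have hxj := hxrec j (by omega)
  rcases Nat.lt_or_ge (j + 1) M with hlt | hge
  · rw [← Finset.sum_subset (Finset.subset_univ
      ({⟨j, by omega⟩, ⟨j + 1, by omega⟩, ⟨j + 1 + 1, by omega⟩} : Finset (Fin (M + 1))))]
    · rw [Finset.sum_insert (by simp [Fin.ext_iff]; try omega), Finset.sum_pair (by simp)]
      have hR := hRrec (j + 1) (by omega) (by omega)
      have hU := hinv (j + 1) (by omega) (by omega)
      simp only [Nat.add_sub_cancel] at hR
      rw [hxrec (j + 1) hlt, Matrix.vecMul_vecMul, ← Matrix.vecMul_add, hxj,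
        Matrix.vecMul_vecMul, ← Matrix.vecMul_add, hR, Matrix.mul_assoc,
        Matrix.nonsing_inv_mul _ ((Matrix.isUnit_iff_isUnit_det _).1 hU)]
      simp
    · intro l _ hl
      apply hzero
      simp only [Finset.mem_insert, Finset.mem_singleton, Fin.ext_iff] at hl
      simp only
      omega
  · obtain rfl : M = j + 1 := by omega
    rw [← Finset.sum_subset (Finset.subset_univ
      ({⟨j, by omega⟩, ⟨j + 1, by omega⟩} : Finset (Fin (j + 1 + 1))))]
    · rw [Finset.sum_pair (by simp)]
      simp only [Nat.add_sub_cancel] at hRtop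
      rw [hxj, Matrix.vecMul_vecMul, ← Matrix.vecMul_add, hRtop, Matrix.mul_assoc,
        Matrix.nonsing_inv_mul _ ((Matrix.isUnit_iff_isUnit_det _).1 hinvtop)]
      simp
    · intro l _ hl
      apply hzero
      simp only [Finset.mem_insert, Finset.mem_singleton, Fin.ext_iff] at hl
      simp only
      omega
end
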